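/- arXiv:1811.05188 — 10 statements merged into one kernel-verified Lean document; each statement's English description precedes it below -/
import Mathlib

section
/- For every n ≥ 0, the minimum of the internal polynomial p_n over the interval [−1, 1] is attained at the origin and is strictly positive; that is, 0 < p_n(0) and p_n(0) ≤ p_n(x) for all x ∈ [−1, 1]. -/
/-- Internal polynomial approximations to the absolute value:
`p 0 x = 1`, `p (n+1) x = (1/2)(2 pₙ(x) − pₙ(x)² + x²)`. -/
noncomputable def internalP : ℕ → ℝ → ℝ
  | 0, _ => 1
  | n + 1, x => (1 / 2) * (2 * internalP n x - (internalP n x) ^ 2 + x ^ 2)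

theorem internalP_le_one (n : ℕ) {x : ℝ} (hx : x ∈ Set.Icc (-1 : ℝ) 1) :
    internalP n x ≤ 1 := by
  cases n with
  | zero => simp [internalP]
  | succ n =>
    have hx2 : x ^ 2 ≤ 1 := by nlinarith [hx.1, hx.2]
    simp only [internalP]
    nlinarith [sq_nonneg (internalP n x - 1)]

theorem internalP_min_at_origin (n : ℕ) :
    0 < internalP n 0 ∧
      ∀ x ∈ Set.Icc (-1 : ℝ) 1, internalP n 0 ≤ internalP n x := by
  induction n with
  | zero => simp [internalP]
  | succ n ih =>
    obtain ⟨hpos, hmin⟩ := ih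
    have h0 : internalP n 0 ≤ 1 := internalP_le_one n (by norm_num)
    refine ⟨?_, fun x hx => ?_⟩
    · simp only [internalP]
      nlinarith
    · have h1 := internalP_le_one n hx
      have hle := hmin x hx
      simp only [internalP]
      nlinarith [mul_nonneg (sub_nonneg.2 hle)
        (by linarith : 0 ≤ 2 - internalP n x - internalP n 0), sq_nonneg x]
end

section
/- For every n ≥ 0 and every x ∈ [−1, 1], the internal polynomials form a decreasing sequence trapped between |x| and 1: |x| ≤ p_{n+1}(x) ≤ p_n(x) ≤ 1. -/
theorem internalP_succ (n : ℕ) (x : ℝ) :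
    internalP (n + 1) x = (1 / 2) * (2 * internalP n x - (internalP n x) ^ 2 + x ^ 2) := rfl

theorem abs_le_internalP_succ {n : ℕ} {x : ℝ} (hx : |x| ≤ 1) (hl : |x| ≤ internalP n x)
    (hu : internalP n x ≤ 1) : |x| ≤ internalP (n + 1) x := by
  rw [internalP_succ, ← sq_abs x]
  nlinarith [mul_nonneg (sub_nonneg.2 hl)
    (show 0 ≤ 2 - (internalP n x + |x|) by linarith)]

theorem internalP_succ_le {n : ℕ} {x : ℝ} (hl : |x| ≤ internalP n x) :
    internalP (n + 1) x ≤ internalP n x := by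
  rw [internalP_succ]
  linarith [sq_le_sq.2 (hl.trans (le_abs_self _))]

theorem internalP_mem_Icc (n : ℕ) {x : ℝ} (hx : |x| ≤ 1) :
    internalP n x ∈ Set.Icc |x| 1 := by
  induction n with
  | zero => exact ⟨hx, le_rfl⟩
  | succ n ih => exact ⟨abs_le_internalP_succ hx ih.1 ih.2, (internalP_succ_le ih.1).trans ih.2⟩

theorem internalP_decreasing_trapped (n : ℕ) (x : ℝ)
    (hx : x ∈ Set.Icc (-1 : ℝ) 1) :
    |x| ≤ internalP (n + 1) x ∧ internalP (n + 1) x ≤ internalP n x ∧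
      internalP n x ≤ 1 := by
  obtain ⟨hl, hu⟩ := internalP_mem_Icc n (abs_le.2 hx)
  exact ⟨abs_le_internalP_succ (abs_le.2 hx) hl hu, internalP_succ_le hl, hu⟩
end

section
/- For all real numbers a and x with |x| ≤ a ≤ 1 and 0 < a, the single step of the [1/1] Padé iteration stays trapped between |x| and a: |x| ≤ a(a² + 3x²)/(3a² + x²) ≤ a. -/
theorem pade11_step_trapped (a x : ℝ) (h₁ : |x| ≤ a) (h₂ : a ≤ 1) (h₃ : 0 < a) :
    |x| ≤ a * (a ^ 2 + 3 * x ^ 2) / (3 * a ^ 2 + x ^ 2) ∧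
      a * (a ^ 2 + 3 * x ^ 2) / (3 * a ^ 2 + x ^ 2) ≤ a := by
  have hd : 0 < 3 * a ^ 2 + |x| ^ 2 := by positivity
  rw [← sq_abs x, le_div_iff₀ hd, div_le_iff₀ hd]
  constructor
  · linarith [pow_nonneg (sub_nonneg.2 h₁) 3]
  · have hsq : |x| ^ 2 ≤ a ^ 2 := by gcongr
    gcongr a * ?_
    linarith
end

section
/- For every n ≥ 0 and every x ∈ [−1, 1], the Padé approximants of order [1/1] satisfy 0 < r_n(x) ≤ 1 and the chain |x| ≤ r_{n+1}(x) ≤ r_n(x) ≤ 1; in particular the sequence (r_n(x)) is decreasing and bounded below by |x|. -/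
/-- Padé approximants of order [1/1] to the absolute value:
`r 0 x = 1`, `r (n+1) x = rₙ(x)(rₙ(x)² + 3x²)/(3rₙ(x)² + x²)`. -/
noncomputable def padeR : ℕ → ℝ → ℝ
  | 0, _ => 1
  | n + 1, x =>
      padeR n x * ((padeR n x) ^ 2 + 3 * x ^ 2) / (3 * (padeR n x) ^ 2 + x ^ 2)

theorem abs_le_padeR_succ {n : ℕ} {x : ℝ} (hpos : 0 < padeR n x) (hx : |x| ≤ padeR n x) :
    |x| ≤ padeR (n + 1) x := by
  have hd : 0 < 3 * padeR n x ^ 2 + x ^ 2 := by positivity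
  rw [padeR, le_div_iff₀ hd, ← sq_abs x]
  nlinarith [pow_nonneg (sub_nonneg.2 hx) 3]

theorem padeR_succ_le {n : ℕ} {x : ℝ} (hpos : 0 < padeR n x) (hx : |x| ≤ padeR n x) :
    padeR (n + 1) x ≤ padeR n x := by
  have hd : 0 < 3 * padeR n x ^ 2 + x ^ 2 := by positivity
  have hsq : x ^ 2 ≤ padeR n x ^ 2 := sq_le_sq.2 (hx.trans (le_abs_self _))
  rw [padeR, div_le_iff₀ hd]
  exact mul_le_mul_of_nonneg_left (by linarith) hpos.le

theorem padeR_pos (n : ℕ) (x : ℝ) : 0 < padeR n x := by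
  induction n with
  | zero => simp [padeR]
  | succ n ih =>
    rw [padeR]
    positivity

theorem abs_le_padeR (n : ℕ) {x : ℝ} (hx : |x| ≤ 1) : |x| ≤ padeR n x := by
  induction n with
  | zero => simpa [padeR] using hx
  | succ n ih => exact abs_le_padeR_succ (padeR_pos n x) ih

theorem padeR_le_one (n : ℕ) {x : ℝ} (hx : |x| ≤ 1) : padeR n x ≤ 1 := by
  induction n with
  | zero => simp [padeR]
  | succ n ih => exact (padeR_succ_le (padeR_pos n x) (abs_le_padeR n hx)).trans ih

theorem padeR_decreasing_trapped (n : ℕ) (x : ℝ)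
    (hx : x ∈ Set.Icc (-1 : ℝ) 1) :
    0 < padeR n x ∧ padeR n x ≤ 1 ∧
      |x| ≤ padeR (n + 1) x ∧ padeR (n + 1) x ≤ padeR n x := by
  have hx' : |x| ≤ 1 := abs_le.2 hx
  exact ⟨padeR_pos n x, padeR_le_one n hx', abs_le_padeR (n + 1) hx',
    padeR_succ_le (padeR_pos n x) (abs_le_padeR n hx')⟩
end

section
/- For every n ≥ 0, the minimum of the Padé approximant r_n of order [1/1] over [−1, 1] is attained at the origin and is strictly positive; that is, 0 < r_n(0) and r_n(0) ≤ r_n(x) for all x ∈ [−1, 1]. -/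
theorem padeR_zero_right (n : ℕ) : padeR n 0 = (1 / 3) ^ n := by
  induction n with
  | zero => simp [padeR]
  | succ n ih =>
    have h : ((1 : ℝ) / 3) ^ n ≠ 0 := by positivity
    rw [padeR, ih, pow_succ (1 / 3 : ℝ) n]
    generalize ((1 : ℝ) / 3) ^ n = a at h ⊢
    field_simp
    ring

theorem padeR_div_three_le_succ (n : ℕ) (x : ℝ) : padeR n x / 3 ≤ padeR (n + 1) x := by
  have h := padeR_pos n x
  rw [padeR, div_le_div_iff₀ (by norm_num) (by positivity), mul_assoc]
  refine mul_le_mul_of_nonneg_left ?_ h.le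
  nlinarith [sq_nonneg x]

theorem one_third_pow_le_padeR (n : ℕ) (x : ℝ) : (1 / 3) ^ n ≤ padeR n x := by
  induction n with
  | zero => simp [padeR]
  | succ n ih =>
    have h := padeR_div_three_le_succ n x
    rw [pow_succ]
    linarith

theorem padeR_min_at_origin (n : ℕ) :
    0 < padeR n 0 ∧
      ∀ x ∈ Set.Icc (-1 : ℝ) 1, padeR n 0 ≤ padeR n x := by
  refine ⟨padeR_pos n 0, fun x _ => ?_⟩
  rw [padeR_zero_right]
  exact one_third_pow_le_padeR n x
end

section
/- The sequence of Padé approximants r_n of order [1/1] converges uniformly to the absolute value function on [−1, 1]; that is, sup_{x ∈ [−1,1]} |r_n(x) − |x|| → 0 as n → ∞. -/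
theorem padeR_succ_sub_abs {n : ℕ} {x : ℝ} (h : 0 < padeR n x) :
    padeR (n + 1) x - |x| = (padeR n x - |x|) ^ 3 / (3 * padeR n x ^ 2 + x ^ 2) := by
  have hd : 3 * padeR n x ^ 2 + x ^ 2 ≠ 0 := by positivity
  rw [padeR, eq_div_iff hd, sub_mul, div_mul_cancel₀ _ hd, ← sq_abs x]
  ring

theorem padeR_pos_and_abs_le {x : ℝ} (hx : |x| ≤ 1) (n : ℕ) :
    0 < padeR n x ∧ |x| ≤ padeR n x := by
  induction n with
  | zero => simpa [padeR] using hx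
  | succ n ih =>
    obtain ⟨hpos, hle⟩ := ih
    refine ⟨by rw [padeR]; positivity, sub_nonneg.mp ?_⟩
    rw [padeR_succ_sub_abs hpos]
    have := sub_nonneg.mpr hle
    positivity

theorem padeR_sub_abs_le {x : ℝ} (hx : |x| ≤ 1) (n : ℕ) :
    padeR n x - |x| ≤ (1 / 3) ^ n := by
  induction n with
  | zero => simp [padeR]
  | succ n ih =>
    obtain ⟨hpos, hle⟩ := padeR_pos_and_abs_le hx n
    have he : 0 ≤ padeR n x - |x| := sub_nonneg.mpr hle
    have hsq : (padeR n x - |x|) ^ 2 ≤ padeR n x ^ 2 :=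
      pow_le_pow_left₀ he (sub_le_self _ (abs_nonneg x)) 2
    calc padeR (n + 1) x - |x|
        = (padeR n x - |x|) ^ 3 / (3 * padeR n x ^ 2 + x ^ 2) := padeR_succ_sub_abs hpos
      _ ≤ (padeR n x - |x|) / 3 := by
        rw [div_le_iff₀ (by positivity)]
        nlinarith [mul_le_mul_of_nonneg_left hsq he, mul_nonneg he (sq_nonneg x)]
      _ ≤ (1 / 3) ^ (n + 1) := by rw [pow_succ]; linarith

theorem padeR_tendstoUniformly :
    TendstoUniformlyOn (fun n x => padeR n x) (fun x => |x|)
      Filter.atTop (Set.Icc (-1 : ℝ) 1) := by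
  rw [Metric.tendstoUniformlyOn_iff]
  intro ε hε
  have hlim : Filter.Tendsto (fun n : ℕ => (1 / 3 : ℝ) ^ n) Filter.atTop (nhds 0) :=
    tendsto_pow_atTop_nhds_zero_of_lt_one (by norm_num) (by norm_num)
  filter_upwards [hlim.eventually_lt_const hε] with n hn x hx
  have hx' : |x| ≤ 1 := abs_le.mpr hx
  rw [dist_comm, Real.dist_eq,
    abs_of_nonneg (sub_nonneg.mpr (padeR_pos_and_abs_le hx' n).2)]
  exact (padeR_sub_abs_le hx' n).trans_lt hn
end

section
/- For all real numbers a and x with |x| ≤ a ≤ 1 and 0 < a, the single step of the [2/2] Padé iteration stays trapped between |x| and a: |x| ≤ a(a⁴ + 10a²x² + 5x⁴)/(5a⁴ + 10a²x² + x⁴) ≤ a. -/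
theorem pade22_step_trapped (a x : ℝ) (h₁ : |x| ≤ a) (h₂ : a ≤ 1) (h₃ : 0 < a) :
    |x| ≤ a * (a ^ 4 + 10 * a ^ 2 * x ^ 2 + 5 * x ^ 4) /
        (5 * a ^ 4 + 10 * a ^ 2 * x ^ 2 + x ^ 4) ∧
      a * (a ^ 4 + 10 * a ^ 2 * x ^ 2 + 5 * x ^ 4) /
        (5 * a ^ 4 + 10 * a ^ 2 * x ^ 2 + x ^ 4) ≤ a := by
  have hx₂ : x ^ 2 = |x| ^ 2 := (sq_abs x).symm
  have hx₄ : x ^ 4 = |x| ^ 4 := (Even.pow_abs (by decide) x).symm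
  have hpos : 0 < 5 * a ^ 4 + 10 * a ^ 2 * x ^ 2 + x ^ 4 := by positivity
  constructor
  · rw [le_div_iff₀ hpos, hx₂, hx₄]
    have h : 0 ≤ (a - |x|) ^ 5 := pow_nonneg (sub_nonneg.2 h₁) 5
    linarith
  · rw [div_le_iff₀ hpos]
    have h : x ^ 4 ≤ a ^ 4 := hx₄ ▸ pow_le_pow_left₀ (abs_nonneg x) h₁ 4
    exact mul_le_mul_of_nonneg_left (by linarith) h₃.le
end

section
/- For every x ∈ [−1, 1], the Padé approximants of order [2/2] satisfy 0 < s_n(x) ≤ 1 and |x| ≤ s_{n+1}(x) ≤ s_n(x) ≤ 1 for all n ≥ 0, and the sequence (s_n(x)) converges to |x| as n → ∞. -/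
/-- Padé approximants of order [2/2] to the absolute value:
`s 0 x = 1`,
`s (n+1) x = sₙ(x)(sₙ(x)⁴ + 10sₙ(x)²x² + 5x⁴)/(5sₙ(x)⁴ + 10sₙ(x)²x² + x⁴)`. -/
noncomputable def padeS : ℕ → ℝ → ℝ
  | 0, _ => 1
  | n + 1, x =>
      padeS n x * ((padeS n x) ^ 4 + 10 * (padeS n x) ^ 2 * x ^ 2 + 5 * x ^ 4) /
        (5 * (padeS n x) ^ 4 + 10 * (padeS n x) ^ 2 * x ^ 2 + x ^ 4)

theorem padeS_pos (x : ℝ) (n : ℕ) : 0 < padeS n x := by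
  induction n with
  | zero => simp [padeS]
  | succ n ih => rw [padeS]; positivity

theorem padeS_succ_sub_abs (x : ℝ) (n : ℕ) :
    padeS (n + 1) x - |x| = (padeS n x - |x|) ^ 5 /
      (5 * padeS n x ^ 4 + 10 * padeS n x ^ 2 * x ^ 2 + x ^ 4) := by
  have hs := padeS_pos x n
  have h2 : x ^ 2 = |x| ^ 2 := (sq_abs x).symm
  have h4 : x ^ 4 = |x| ^ 4 := ((by decide : Even 4).pow_abs x).symm
  rw [padeS, h2, h4]
  generalize |x| = a
  have hD : 5 * padeS n x ^ 4 + 10 * padeS n x ^ 2 * a ^ 2 + a ^ 4 ≠ 0 := by positivity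
  rw [eq_div_iff hD, sub_mul, div_mul_cancel₀ _ hD]
  ring

theorem abs_le_padeS {x : ℝ} (hx : |x| ≤ 1) (n : ℕ) : |x| ≤ padeS n x := by
  induction n with
  | zero => simpa [padeS] using hx
  | succ n ih =>
    have hs := padeS_pos x n
    rw [← sub_nonneg] at ih ⊢
    rw [padeS_succ_sub_abs]
    positivity

theorem padeS_succ_sub_abs_le {x : ℝ} (hx : |x| ≤ 1) (n : ℕ) :
    padeS (n + 1) x - |x| ≤ (padeS n x - |x|) / 5 := by
  have hs := padeS_pos x n
  have hd : 0 ≤ padeS n x - |x| := sub_nonneg.2 (abs_le_padeS hx n)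
  have h4 : (padeS n x - |x|) ^ 4 ≤ padeS n x ^ 4 :=
    pow_le_pow_left₀ hd (sub_le_self _ (abs_nonneg x)) 4
  have h5 : 5 * (padeS n x - |x|) ^ 4 ≤
      5 * padeS n x ^ 4 + 10 * padeS n x ^ 2 * x ^ 2 + x ^ 4 := by
    have : 0 ≤ 10 * padeS n x ^ 2 * x ^ 2 + x ^ 4 := by positivity
    linarith
  rw [padeS_succ_sub_abs, div_le_div_iff₀ (by positivity) (by norm_num)]
  calc (padeS n x - |x|) ^ 5 * 5 = (padeS n x - |x|) * (5 * (padeS n x - |x|) ^ 4) := by ring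
    _ ≤ _ := mul_le_mul_of_nonneg_left h5 hd

theorem padeS_succ_le {x : ℝ} (hx : |x| ≤ 1) (n : ℕ) : padeS (n + 1) x ≤ padeS n x := by
  linarith [padeS_succ_sub_abs_le hx n, abs_le_padeS hx n]

theorem padeS_sub_abs_le {x : ℝ} (hx : |x| ≤ 1) (n : ℕ) :
    padeS n x - |x| ≤ (1 / 5) ^ n := by
  induction n with
  | zero => simp [padeS]
  | succ n ih =>
    rw [pow_succ]
    linarith [padeS_succ_sub_abs_le hx n]

theorem padeS_monotone_and_converges (x : ℝ) (hx : x ∈ Set.Icc (-1 : ℝ) 1) :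
    (∀ n : ℕ, 0 < padeS n x ∧ padeS n x ≤ 1 ∧
      |x| ≤ padeS (n + 1) x ∧ padeS (n + 1) x ≤ padeS n x) ∧
      Filter.Tendsto (fun n => padeS n x) Filter.atTop (nhds |x|) := by
  have h1 : |x| ≤ 1 := abs_le.2 hx
  refine ⟨fun n => ⟨padeS_pos x n, ?_, abs_le_padeS h1 _, padeS_succ_le h1 n⟩, ?_⟩
  · exact antitone_nat_of_succ_le (f := fun n => padeS n x) (padeS_succ_le h1) (Nat.zero_le n)
  · have h0 : Filter.Tendsto (fun n : ℕ => |x| + (1 / 5 : ℝ) ^ n) Filter.atTop (nhds |x|) := by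
      simpa using (tendsto_pow_atTop_nhds_zero_of_lt_one (r := (1 / 5 : ℝ))
        (by norm_num) (by norm_num)).const_add |x|
    exact tendsto_of_tendsto_of_tendsto_of_le_of_le tendsto_const_nhds h0
      (abs_le_padeS h1) fun n => sub_le_iff_le_add'.1 (padeS_sub_abs_le h1 n)
end

section
/- Let V be a real vector space, let S_L < 0 < S_R and S_D < 0 < S_U be real numbers, and let U_{LD}, U_{LU}, U_{RD}, U_{RU}, F_{LD}, F_{LU}, F_{RD}, F_{RU}, G_{LD}, G_{LU}, G_{RD}, G_{RU}, F_L*, F_R* be vectors in V. Define the HLL states U_L* = (S_U U_{LU} − S_D U_{LD} + G_{LD} − G_{LU})/(S_U − S_D) and U_R* = (S_U U_{RU} − S_D U_{RD} + G_{RD} − G_{RU})/(S_U − S_D), the one-dimensional HLL fluxes F_U* = (S_R F_{LU} − S_L F_{RU} + S_L S_R (U_{RU} − U_{LU}))/(S_R − S_L) and F_D* = (S_R F_{LD} − S_L F_{RD} + S_L S_R (U_{RD} − U_{LD}))/(S_R − S_L), and the subsonic HLL viscosity coefficients α₀ = −2 S_L S_R/(S_R − S_L) and α₁ = (S_R + S_L)/(S_R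 − S_L). Then the AVM-type flux with the HLL coefficients coincides with Balsara's two-dimensional HLL resolved flux: (F_L* + F_R*)/2 − (1/2)[α₀(U_R* − U_L*) + α₁(F_R* − F_L*)] = [S_U/(S_U − S_D)] F_U* − [S_D/(S_U − S_D)] F_D* − [S_L S_R/((S_R − S_L)(S_U − S_D))](G_{RU} − G_{LU} + G_{LD} − G_{RD}) + [S_L S_U (F_{RU} − F_R*) − S_R S_U (F_{LU} − F_L*) + S_R S_D (F_{LD} − F_L*) − S_L S_D (F_{RD} − F_R*)]/((S_R − S_L)(S_U − S_D)). -/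
theorem avm_hll_flux_eq_balsara {V : Type*} [AddCommGroup V] [Module ℝ V]
    (S_L S_R S_D S_U : ℝ)
    (hL : S_L < 0) (hR : 0 < S_R) (hD : S_D < 0) (hU : 0 < S_U)
    (U_LD U_LU U_RD U_RU F_LD F_LU F_RD F_RU
      G_LD G_LU G_RD G_RU FL FR UL UR FUstar FDstar : V)
    (α₀ α₁ : ℝ)
    (hUL : UL = (S_U - S_D)⁻¹ • (S_U • U_LU - S_D • U_LD + G_LD - G_LU))
    (hUR : UR = (S_U - S_D)⁻¹ • (S_U • U_RU - S_D • U_RD + G_RD - G_RU))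
    (hFU : FUstar = (S_R - S_L)⁻¹ •
      (S_R • F_LU - S_L • F_RU + (S_L * S_R) • (U_RU - U_LU)))
    (hFD : FDstar = (S_R - S_L)⁻¹ •
      (S_R • F_LD - S_L • F_RD + (S_L * S_R) • (U_RD - U_LD)))
    (hα₀ : α₀ = -2 * S_L * S_R / (S_R - S_L))
    (hα₁ : α₁ = (S_R + S_L) / (S_R - S_L)) :
    (1 / 2 : ℝ) • (FL + FR) -
        (1 / 2 : ℝ) • (α₀ • (UR - UL) + α₁ • (FR - FL)) =
      (S_U / (S_U - S_D)) • FUstar - (S_D / (S_U - S_D)) • FDstar -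
        (S_L * S_R / ((S_R - S_L) * (S_U - S_D))) •
          (G_RU - G_LU + G_LD - G_RD) +
        (((S_R - S_L) * (S_U - S_D))⁻¹) •
          ((S_L * S_U) • (F_RU - FR) - (S_R * S_U) • (F_LU - FL) +
            (S_R * S_D) • (F_LD - FL) - (S_L * S_D) • (F_RD - FR)) := by
  have hx : S_R - S_L ≠ 0 := by linarith
  have hy : S_U - S_D ≠ 0 := by linarith
  subst hUL hUR hFU hFD hα₀ hα₁
  match_scalars <;> field_simp <;> ring
end

section
/- Let d ≥ 1 and let B, v : ℝ × ℝ^d → ℝ^d be twice continuously differentiable functions of time t and space x = (x_1, …, x_d). Suppose that for each component i and every (t, x), ∂_t B_i + Σ_{j=1}^{d} ∂_{x_j}(B_i v_j − v_i B_j) = −(Σ_{j=1}^{d} ∂_{x_j} B_j) v_i (Powell's nonconservative induction equation). Then the divergence of B is advected by the velocity field: ∂_t(div B) + Σ_{i=1}^{d} ∂_{x_i}((div B) v_i) = 0 at every (t, x), where div B = Σ_{j=1}^{d} ∂_{x_j} B_j. -/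
/-- Partial derivative with respect to time of a scalar field on
space-time `ℝ × ℝ^d`. -/
noncomputable def partialT {d : ℕ} (f : ℝ × (Fin d → ℝ) → ℝ)
    (p : ℝ × (Fin d → ℝ)) : ℝ :=
  fderiv ℝ f p (1, 0)

/-- Partial derivative with respect to the `j`-th space variable of a
scalar field on space-time `ℝ × ℝ^d`. -/
noncomputable def partialX {d : ℕ} (j : Fin d) (f : ℝ × (Fin d → ℝ) → ℝ)
    (p : ℝ × (Fin d → ℝ)) : ℝ :=
  fderiv ℝ f p (0, Pi.single j 1)

/-- Divergence of a time-dependent vector field on `ℝ^d`. -/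
noncomputable def divergence {d : ℕ} (B : ℝ × (Fin d → ℝ) → Fin d → ℝ)
    (p : ℝ × (Fin d → ℝ)) : ℝ :=
  ∑ j : Fin d, partialX j (fun q => B q j) p

section SecondDerivatives

variable {E : Type*} [NormedAddCommGroup E] [NormedSpace ℝ E]

theorem ContDiff.differentiable_fderiv_apply_const {f : E → ℝ} (hf : ContDiff ℝ 2 f) (u : E) :
    Differentiable ℝ (fun q => fderiv ℝ f q u) :=
  ((hf.fderiv_right (m := 1) (by norm_num)).differentiable (by norm_num)).clm_apply
    (differentiable_const u)

theorem ContDiff.fderiv_fderiv_apply_comm {f : E → ℝ} (hf : ContDiff ℝ 2 f) (u w p : E) :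
    fderiv ℝ (fun q => fderiv ℝ f q w) p u = fderiv ℝ (fun q => fderiv ℝ f q u) p w := by
  have hd : DifferentiableAt ℝ (fderiv ℝ f) p :=
    (hf.fderiv_right (m := 1) (by norm_num)).differentiable (by norm_num) p
  have key (a b : E) :
      fderiv ℝ (fun q => fderiv ℝ f q b) p a = fderiv ℝ (fderiv ℝ f) p a b := by
    rw [fderiv_clm_apply hd (differentiableAt_const b)]
    simp
  rw [key, key]
  exact (hf.contDiffAt.isSymmSndFDerivAt (by simp)).eq u w

/-- The double divergence of an antisymmetric `C²` tensor field vanishes. -/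
theorem sum_sum_fderiv_fderiv_eq_zero_of_antisymm {ι : Type*} [Fintype ι] (e : ι → E)
    {F : ι → ι → E → ℝ} (hF : ∀ i j, ContDiff ℝ 2 (F i j)) (hanti : ∀ i j, F j i = -F i j)
    (p : E) :
    ∑ i, ∑ j, fderiv ℝ (fun q => fderiv ℝ (F i j) q (e j)) p (e i) = 0 := by
  have h : ∑ i, ∑ j, fderiv ℝ (fun q => fderiv ℝ (F i j) q (e j)) p (e i) =
      -∑ i, ∑ j, fderiv ℝ (fun q => fderiv ℝ (F i j) q (e j)) p (e i) := by
    conv_lhs => rw [Finset.sum_comm]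
    simp only [← Finset.sum_neg_distrib]
    refine Finset.sum_congr rfl fun i _ => Finset.sum_congr rfl fun j _ => ?_
    simp only [hanti i j, fderiv_neg, neg_apply, fderiv_fun_neg]
    rw [(hF i j).fderiv_fderiv_apply_comm]
  linarith

end SecondDerivatives

theorem powell_divergence_advection {d : ℕ} (hd : 1 ≤ d)
    (B v : ℝ × (Fin d → ℝ) → Fin d → ℝ)
    (hB : ContDiff ℝ 2 B) (hv : ContDiff ℝ 2 v)
    (hPowell : ∀ (i : Fin d) (p : ℝ × (Fin d → ℝ)),
      partialT (fun q => B q i) p +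
          ∑ j : Fin d,
            partialX j (fun q => B q i * v q j - v q i * B q j) p =
        -(∑ j : Fin d, partialX j (fun q => B q j) p) * v p i) :
    ∀ p : ℝ × (Fin d → ℝ),
      partialT (divergence B) p +
          ∑ i : Fin d, partialX i (fun q => divergence B q * v q i) p = 0 := by
  intro p
  have hBi (i : Fin d) : ContDiff ℝ 2 (fun q => B q i) := contDiff_pi.1 hB i
  have hvi (i : Fin d) : ContDiff ℝ 2 (fun q => v q i) := contDiff_pi.1 hv i
  have hF (i j : Fin d) : ContDiff ℝ 2 (fun q => B q i * v q j - v q i * B q j) :=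
    ((hBi i).mul (hvi j)).sub ((hvi i).mul (hBi j))
  have htime : partialT (divergence B) p =
      ∑ i, partialX i (partialT (fun q => B q i)) p := by
    simp only [partialT, partialX]
    rw [show divergence B = fun q => ∑ i, fderiv ℝ (fun q => B q i) q (0, Pi.single i 1)
        from rfl,
      fderiv_fun_sum fun i _ => (hBi i).differentiable_fderiv_apply_const _ p]
    simp only [sum_apply]
    exact Finset.sum_congr rfl fun i _ => (hBi i).fderiv_fderiv_apply_comm _ _ p
  have hflux (i : Fin d) : partialX i (fun q => divergence B q * v q i) p =
      -partialX i (partialT (fun q => B q i)) p -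
        ∑ j, partialX i (partialX j (fun q => B q i * v q j - v q i * B q j)) p := by
    have hrw : (fun q => divergence B q * v q i) = fun q => -partialT (fun q => B q i) q -
        ∑ j, partialX j (fun q => B q i * v q j - v q i * B q j) q := by
      funext q
      have h := hPowell i q
      simp only [divergence]
      linarith
    have hT : DifferentiableAt ℝ (partialT (fun q => B q i)) p :=
      (hBi i).differentiable_fderiv_apply_const _ p
    have hX (j : Fin d) :
        DifferentiableAt ℝ (partialX j (fun q => B q i * v q j - v q i * B q j)) p :=
      (hF i j).differentiable_fderiv_apply_const _ p
    rw [hrw]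
    unfold partialX at hX ⊢
    rw [fderiv_fun_sub hT.fun_neg (DifferentiableAt.fun_sum fun j _ => hX j), fderiv_fun_neg,
      fderiv_fun_sum fun j _ => hX j]
    simp
  have hzero : ∑ i, ∑ j,
      partialX i (partialX j (fun q => B q i * v q j - v q i * B q j)) p = 0 :=
    sum_sum_fderiv_fderiv_eq_zero_of_antisymm
      (fun j : Fin d => ((0 : ℝ), (Pi.single j 1 : Fin d → ℝ))) hF
      (fun i j => by funext q; simp only [Pi.neg_apply]; ring) p
  rw [htime, Finset.sum_congr rfl fun i _ => hflux i, Finset.sum_sub_distrib, hzero,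
    Finset.sum_neg_distrib]
  ring
end
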